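/- Let n be a nonnegative integer, let κ be a nonzero real number and b a real number. Then ∫₀^b t^n e^{iκt} J_n(κt) dt = (e^{iκb} b^{n+1}/(2n+1)) · ( J_n(κb) − i J_{n+1}(κb) ). -/

import Mathlib

open Real MeasureTheory Complex

/-- Bessel function of the first kind of nonnegative integer order `m`. -/
noncomputable def besselJ (m : ℕ) (x : ℝ) : ℝ :=
  ∑' j : ℕ, ((-1 : ℝ) ^ j / ((j.factorial : ℝ) * ((j + m).factorial : ℝ))) * (x / 2) ^ (2 * j + m)

/-- The entire function `E_m` with `J_m(x) = (x/2)^m E_m((x/2)^2)`. -/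
noncomputable def besselE (m : ℕ) (y : ℝ) : ℝ :=
  ∑' j : ℕ, ((-1 : ℝ) ^ j / ((j.factorial : ℝ) * ((j + m).factorial : ℝ))) * y ^ j

theorem abs_besselE_coeff_le (m j : ℕ) :
    |(-1 : ℝ) ^ j / ((j.factorial : ℝ) * ((j + m).factorial : ℝ))| ≤ 1 / (j.factorial : ℝ) := by
  have hj : (0 : ℝ) < j.factorial := by positivity
  have hm : (1 : ℝ) ≤ (j + m).factorial := by exact_mod_cast Nat.one_le_iff_ne_zero.2 (by positivity)
  rw [abs_div, abs_pow, abs_neg, abs_one, one_pow, abs_of_pos (by positivity)]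
  exact one_div_le_one_div_of_le hj (le_mul_of_one_le_right hj.le hm)

theorem summable_besselE (m : ℕ) (y : ℝ) :
    Summable fun j : ℕ =>
      ((-1 : ℝ) ^ j / ((j.factorial : ℝ) * ((j + m).factorial : ℝ))) * y ^ j := by
  refine Summable.of_norm_bounded (Real.summable_pow_div_factorial |y|) fun j => ?_
  rw [norm_mul, Real.norm_eq_abs, norm_pow, Real.norm_eq_abs, ← one_div_mul_eq_div (j.factorial : ℝ)]
  exact mul_le_mul_of_nonneg_right (abs_besselE_coeff_le m j) (pow_nonneg (abs_nonneg y) j)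

theorem besselE_deriv_term (m j : ℕ) (y : ℝ) :
    ((-1 : ℝ) ^ (j + 1) / (((j + 1).factorial : ℝ) * ((j + 1 + m).factorial : ℝ))) *
        (((j + 1 : ℕ) : ℝ) * y ^ j) =
      -(((-1 : ℝ) ^ j / ((j.factorial : ℝ) * ((j + (m + 1)).factorial : ℝ))) * y ^ j) := by
  have h : j + 1 + m = j + (m + 1) := by ring
  rw [h, Nat.factorial_succ j]
  push_cast
  field_simp
  ring

theorem hasDerivAt_besselE (m : ℕ) (y : ℝ) :
    HasDerivAt (besselE m) (-besselE (m + 1) y) y := by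
  let c : ℕ → ℝ := fun j => (-1 : ℝ) ^ j / ((j.factorial : ℝ) * ((j + m).factorial : ℝ))
  set R : ℝ := |y| + 1
  have hy : y ∈ Metric.ball (0 : ℝ) R := by simp [R]
  have hu : Summable fun j : ℕ => 1 / (j.factorial : ℝ) * ((j : ℝ) * R ^ (j - 1)) := by
    rw [← summable_nat_add_iff 1]
    refine (Real.summable_pow_div_factorial R).congr fun j => ?_
    rw [Nat.factorial_succ, Nat.add_sub_cancel]
    push_cast
    field_simp
  have hd := hasDerivAt_tsum_of_isPreconnected (g := fun j z => c j * z ^ j)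
    (g' := fun j z => c j * ((j : ℝ) * z ^ (j - 1))) hu Metric.isOpen_ball
    (convex_ball (0 : ℝ) R).isPreconnected
    (fun j z _ => (hasDerivAt_pow j z).const_mul (c j))
    (fun j z hz => by
      have hz' : |z| ≤ R := by simpa using (mem_ball_zero_iff.1 hz).le
      rw [norm_mul, norm_mul, norm_pow, Real.norm_eq_abs, Real.norm_eq_abs, Real.norm_eq_abs,
        Nat.abs_cast]
      have := abs_besselE_coeff_le m j
      gcongr)
    hy (summable_besselE m y) hy
  refine hd.congr_deriv ?_
  have hs : Summable fun j : ℕ => c j * ((j : ℝ) * y ^ (j - 1)) := by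
    rw [← summable_nat_add_iff 1]
    refine (summable_besselE (m + 1) y).neg.congr fun j => ?_
    exact (besselE_deriv_term m j y).symm
  rw [hs.tsum_eq_zero_add, besselE, ← tsum_neg]
  simp only [Nat.cast_zero, zero_mul, mul_zero, zero_add]
  exact tsum_congr fun j => besselE_deriv_term m j y

theorem besselE_recurrence (m : ℕ) (y : ℝ) :
    besselE m y = (m + 1) * besselE (m + 1) y - y * besselE (m + 2) y := by
  have h₁ := summable_besselE (m + 1) y
  have h₂ := summable_besselE (m + 2) y
  have h₀ := summable_besselE m y
  have hshift : besselE m y - (m + 1) * besselE (m + 1) y = -(y * besselE (m + 2) y) := by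
    unfold besselE
    rw [← tsum_mul_left, ← tsum_mul_left, ← h₀.tsum_sub (h₁.mul_left _),
      (h₀.sub (h₁.mul_left _)).tsum_eq_zero_add, ← tsum_neg]
    have hzero : ((-1 : ℝ) ^ 0 / (((0 : ℕ).factorial : ℝ) * ((0 + m).factorial : ℝ))) * y ^ 0 -
        ((m : ℝ) + 1) * (((-1 : ℝ) ^ 0 /
          (((0 : ℕ).factorial : ℝ) * ((0 + (m + 1)).factorial : ℝ))) * y ^ 0) = 0 := by
      rw [zero_add, zero_add, Nat.factorial_succ m]
      push_cast
      field_simp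
      simp
    rw [hzero, zero_add]
    refine tsum_congr fun j => ?_
    have e₀ : j + 1 + m = j + m + 1 := by ring
    have e₁ : j + 1 + (m + 1) = j + m + 1 + 1 := by ring
    have e₂ : j + (m + 2) = j + m + 1 + 1 := by ring
    rw [e₀, e₁, e₂, Nat.factorial_succ (j + m + 1), Nat.factorial_succ j]
    push_cast
    field_simp
    ring
  linarith

theorem besselJ_eq_mul_besselE (m : ℕ) (x : ℝ) :
    besselJ m x = (x / 2) ^ m * besselE m ((x / 2) ^ 2) := by
  rw [besselJ, besselE, ← tsum_mul_left]
  refine tsum_congr fun j => ?_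
  rw [pow_add, pow_mul]
  ring

theorem hasDerivAt_besselE_half_sq (m : ℕ) (x : ℝ) :
    HasDerivAt (fun x : ℝ => besselE m ((x / 2) ^ 2))
      (-besselE (m + 1) ((x / 2) ^ 2) * (x / 2)) x := by
  have h : HasDerivAt (fun x : ℝ => (x / 2) ^ 2) (x / 2) x := by
    refine (((hasDerivAt_id x).div_const 2).pow 2).congr_deriv ?_
    simp
    ring
  exact (hasDerivAt_besselE m ((x / 2) ^ 2)).comp x h

theorem continuous_besselJ (m : ℕ) : Continuous (besselJ m) := by
  have hE : Continuous fun x : ℝ => besselE m ((x / 2) ^ 2) :=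
    continuous_iff_continuousAt.2 fun x => (hasDerivAt_besselE_half_sq m x).continuousAt
  rw [funext (besselJ_eq_mul_besselE m)]
  fun_prop

theorem hasDerivAt_pow_succ_mul_besselJ (n : ℕ) (x : ℝ) :
    HasDerivAt (fun x => x ^ (n + 1) * besselJ n x)
      ((2 * n + 1) * x ^ n * besselJ n x - x ^ (n + 1) * besselJ (n + 1) x) x := by
  have hp : HasDerivAt (fun x : ℝ => x ^ (2 * n + 1) / 2 ^ n)
      ((2 * n + 1) * x ^ (2 * n) / 2 ^ n) x := by
    simpa using (hasDerivAt_pow (2 * n + 1) x).div_const (2 ^ n)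
  have h := hp.mul (hasDerivAt_besselE_half_sq n x)
  refine (h.congr_deriv ?_).congr_of_eventuallyEq (.of_forall fun z => ?_)
  rotate_left
  · simp only [besselJ_eq_mul_besselE, Pi.mul_apply, div_pow]
    ring
  · simp only [besselJ_eq_mul_besselE, div_pow]
    ring

theorem hasDerivAt_pow_mul_besselJ_succ (n : ℕ) (x : ℝ) :
    HasDerivAt (fun x => x ^ (n + 1) * besselJ (n + 1) x) (x ^ (n + 1) * besselJ n x) x := by
  have hp : HasDerivAt (fun x : ℝ => x ^ (2 * n + 2) / 2 ^ (n + 1))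
      ((2 * n + 2) * x ^ (2 * n + 1) / 2 ^ (n + 1)) x := by
    simpa using (hasDerivAt_pow (2 * n + 2) x).div_const (2 ^ (n + 1))
  have h := hp.mul (hasDerivAt_besselE_half_sq (n + 1) x)
  refine (h.congr_deriv ?_).congr_of_eventuallyEq (.of_forall fun z => ?_)
  rotate_left
  · simp only [besselJ_eq_mul_besselE, Pi.mul_apply, div_pow]
    ring
  · rw [besselJ_eq_mul_besselE, besselE_recurrence n]
    simp only [div_pow]
    field_simp
    ring

theorem hasDerivAt_exp_mul_besselJ (n : ℕ) (x : ℝ) :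
    HasDerivAt (fun x : ℝ => Complex.exp (Complex.I * x) *
        (((x ^ (n + 1) * besselJ n x : ℝ) : ℂ) -
          Complex.I * ((x ^ (n + 1) * besselJ (n + 1) x : ℝ) : ℂ)))
      ((2 * n + 1) * ((x : ℂ) ^ n * Complex.exp (Complex.I * x) * besselJ n x)) x := by
  have he : HasDerivAt (fun x : ℝ => Complex.exp (Complex.I * x))
      (Complex.exp (Complex.I * x) * Complex.I) x := by
    simpa using ((hasDerivAt_id x).ofReal_comp.const_mul Complex.I).cexp
  refine (he.mul ((hasDerivAt_pow_succ_mul_besselJ n x).ofReal_comp.sub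
    ((hasDerivAt_pow_mul_besselJ_succ n x).ofReal_comp.const_mul Complex.I))).congr_deriv ?_
  simp only [Pi.sub_apply]
  push_cast
  linear_combination -(Complex.exp (Complex.I * x) * (x : ℂ) ^ (n + 1) * besselJ (n + 1) x) *
    Complex.I_sq

theorem stmt_17 (n : ℕ) (κ b : ℝ) (hκ : κ ≠ 0) :
    ∫ t in (0:ℝ)..b, (t : ℂ) ^ n * Complex.exp (Complex.I * κ * t) * (besselJ n (κ * t) : ℂ) =
      (Complex.exp (Complex.I * κ * b) * (b : ℂ) ^ (n + 1) / (2 * (n : ℂ) + 1)) *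
        ((besselJ n (κ * b) : ℂ) - Complex.I * (besselJ (n + 1) (κ * b) : ℂ)) := by
  have hn : (2 * (n : ℂ) + 1) ≠ 0 := by exact_mod_cast Nat.succ_ne_zero (2 * n)
  have hκ' : (κ : ℂ) ≠ 0 := by exact_mod_cast hκ
  have hderiv : ∀ t : ℝ, HasDerivAt
      (fun t : ℝ => (Complex.exp (Complex.I * κ * t) * (t : ℂ) ^ (n + 1) / (2 * (n : ℂ) + 1)) *
        ((besselJ n (κ * t) : ℂ) - Complex.I * (besselJ (n + 1) (κ * t) : ℂ)))
      ((t : ℂ) ^ n * Complex.exp (Complex.I * κ * t) * (besselJ n (κ * t) : ℂ)) t := by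
    intro t
    have hlin : HasDerivAt (fun t : ℝ => κ * t) κ t := by
      simpa using (hasDerivAt_id t).const_mul κ
    have h := ((hasDerivAt_exp_mul_besselJ n (κ * t)).scomp t hlin).div_const
      ((κ : ℂ) ^ (n + 1) * (2 * n + 1))
    refine (h.congr_deriv ?_).congr_of_eventuallyEq (.of_forall fun s => ?_)
    rotate_left
    · simp only [Function.comp_apply]
      push_cast
      rw [← mul_assoc Complex.I]
      field_simp
      ring
    · rw [Complex.real_smul]
      push_cast
      rw [← mul_assoc Complex.I]
      field_simp
      ring
  have hcont : Continuous fun t : ℝ =>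
      (t : ℂ) ^ n * Complex.exp (Complex.I * κ * t) * (besselJ n (κ * t) : ℂ) := by
    have := continuous_besselJ n
    fun_prop
  rw [intervalIntegral.integral_eq_sub_of_hasDerivAt (fun t _ => hderiv t)
    (hcont.intervalIntegrable 0 b)]
  simp
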